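/- Let 𝒞, 𝒟 ⊆ M_{m×n}(𝔽_q) be matrix codes that are left equivalent, i.e., 𝒞 = S·𝒟 for some S ∈ GL_m(𝔽_q). Suppose their left stabilizer algebras are equal and that this common algebra equals 𝔽_q[A] for some A ∈ M_{m×m}(𝔽_q) whose characteristic polynomial is irreducible over 𝔽_q. Then, for any Θ ∈ GL_m(𝔽_q) satisfying Θ^m = I_m and Θ·B·Θ⁻¹ = B^q for all B ∈ 𝔽_q[A], there exists j ∈ {0,…,m−1} such that 𝒞 = Θ^j·𝒟. -/

import Mathlib

open Polynomial in
/-- Evaluation at `A` of polynomials modulo the characteristic polynomial of `A`. -/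
noncomputable def Matrix.adjoinRootCharpolyHom {F ι : Type*} [Field F] [Fintype ι]
    [DecidableEq ι] (A : Matrix ι ι F) : AdjoinRoot A.charpoly →ₐ[F] Matrix ι ι F :=
  Ideal.Quotient.liftₐ (Ideal.span {A.charpoly}) (aeval A) fun p hp => by
    obtain ⟨r, rfl⟩ := Ideal.mem_span_singleton.1 hp
    rw [map_mul, A.aeval_self_charpoly, zero_mul]

open Polynomial in
theorem Matrix.adjoinRootCharpolyHom_mk {F ι : Type*} [Field F] [Fintype ι]
    [DecidableEq ι] (A : Matrix ι ι F) (p : F[X]) :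
    A.adjoinRootCharpolyHom (AdjoinRoot.mk _ p) = aeval A p :=
  rfl

open Polynomial in
/-- A matrix commuting with a matrix whose characteristic polynomial is irreducible is a
polynomial in it. -/
theorem Matrix.exists_eq_aeval_of_commute_of_irreducible_charpoly
    {F ι : Type*} [Field F] [Fintype ι] [DecidableEq ι] {A M : Matrix ι ι F}
    (hA : Irreducible A.charpoly) (hM : Commute M A) : ∃ p : F[X], M = aeval A p := by
  have : Fact (Irreducible A.charpoly) := ⟨hA⟩
  let φ := A.adjoinRootCharpolyHom
  have hφ : ∀ p, φ (AdjoinRoot.mk _ p) = aeval A p := A.adjoinRootCharpolyHom_mk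
  have hcomm (k) : M * φ k = φ k * M := by
    induction k using AdjoinRoot.induction_on with
    | ih p =>
      rw [hφ]
      exact Algebra.commute_of_mem_adjoin_singleton_of_commute
        (aeval_mem_adjoin_singleton F A) hM
  have hι : Nonempty ι := by
    by_contra h
    rw [not_nonempty_iff] at h
    exact hA.natDegree_pos.ne' (by simp)
  obtain ⟨i⟩ := hι
  let v : ι → F := Pi.single i 1
  have hv : v ≠ 0 := by simp [v]
  let ev : AdjoinRoot A.charpoly →ₗ[F] (ι → F) :=
    { toFun := fun k => (φ k).mulVec v
      map_add' := fun x y => by simp [Matrix.add_mulVec]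
      map_smul' := fun c x => by simp [Matrix.smul_mulVec] }
  have hinj : Function.Injective ev := by
    rw [← LinearMap.ker_eq_bot, LinearMap.ker_eq_bot']
    intro k hk
    by_contra hk0
    apply hv
    have h1 : (φ k⁻¹).mulVec ((φ k).mulVec v) = v := by
      rw [Matrix.mulVec_mulVec, ← map_mul, inv_mul_cancel₀ hk0, map_one, Matrix.one_mulVec]
    rw [← h1, show (φ k).mulVec v = 0 from hk, Matrix.mulVec_zero]
  have : FiniteDimensional F (AdjoinRoot A.charpoly) :=
    (AdjoinRoot.powerBasis hA.ne_zero).finite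
  have hsurj : Function.Surjective ev := by
    refine (LinearMap.injective_iff_surjective_of_finrank_eq_finrank ?_).1 hinj
    rw [(AdjoinRoot.powerBasis hA.ne_zero).finrank]
    simp
  obtain ⟨k, hk⟩ := hsurj (M.mulVec v)
  have hk : (φ k).mulVec v = M.mulVec v := hk
  obtain ⟨p, rfl⟩ := AdjoinRoot.mk_surjective k
  refine ⟨p, ?_⟩
  rw [← hφ]
  apply Matrix.mulVec_injective
  funext w
  obtain ⟨l, rfl⟩ := hsurj w
  change M.mulVec ((φ l).mulVec v) = (φ _).mulVec ((φ l).mulVec v)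
  rw [Matrix.mulVec_mulVec, hcomm, ← Matrix.mulVec_mulVec, ← hk, Matrix.mulVec_mulVec,
    Matrix.mulVec_mulVec, ← map_mul, ← map_mul, mul_comm]

open Polynomial in
/-- Over a finite field, a conjugate of `A` that is a polynomial in `A` is an iterated Frobenius
power of `A`, provided `A` has irreducible characteristic polynomial. -/
theorem Matrix.exists_aeval_eq_pow_card_pow_of_charpoly_eq
    {F ι : Type*} [Field F] [Fintype F] [Fintype ι] [DecidableEq ι] {A : Matrix ι ι F}
    (hA : Irreducible A.charpoly) (p : F[X]) (hp : (aeval A p).charpoly = A.charpoly) :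
    ∃ j < Fintype.card ι, aeval A p = A ^ Fintype.card F ^ j := by
  have : Fact (Irreducible A.charpoly) := ⟨hA⟩
  let φ := A.adjoinRootCharpolyHom
  have hφ : ∀ p, φ (AdjoinRoot.mk _ p) = aeval A p := A.adjoinRootCharpolyHom_mk
  have hι : Nonempty ι := by
    by_contra h
    rw [not_nonempty_iff] at h
    exact hA.natDegree_pos.ne' (by simp)
  have hinj : Function.Injective φ := φ.toRingHom.injective
  have : FiniteDimensional F (AdjoinRoot A.charpoly) :=
    (AdjoinRoot.powerBasis hA.ne_zero).finite
  have : Finite (AdjoinRoot A.charpoly) := Module.finite_of_finite F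
  have hroot : aeval (AdjoinRoot.mk A.charpoly p) A.charpoly = 0 := by
    apply hinj
    rw [← aeval_algHom_apply, hφ, map_zero]
    conv_lhs => rw [← hp]
    exact Matrix.aeval_self_charpoly _
  let σ : AdjoinRoot A.charpoly →ₐ[F] AdjoinRoot A.charpoly :=
    AdjoinRoot.liftAlgHom A.charpoly (Algebra.ofId F _) (AdjoinRoot.mk A.charpoly p)
      (by simpa [aeval_def] using hroot)
  obtain ⟨j, hj⟩ := (FiniteField.bijective_frobeniusAlgHom_pow F (AdjoinRoot A.charpoly)).2 σ
  refine ⟨j, ?_, ?_⟩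
  · refine j.2.trans_eq ?_
    rw [(AdjoinRoot.powerBasis hA.ne_zero).finrank, AdjoinRoot.powerBasis_dim,
      Matrix.charpoly_natDegree_eq_dim]
  · have h := DFunLike.congr_fun hj (AdjoinRoot.root A.charpoly)
    have h2 : σ (AdjoinRoot.root A.charpoly) = AdjoinRoot.mk A.charpoly p := by simp [σ]
    have h3 : φ (AdjoinRoot.root A.charpoly) = A := (hφ X).trans (aeval_X A)
    rw [h2] at h
    rw [← hφ, ← h]
    simp only [FiniteField.coe_frobeniusAlgHom, AlgHom.coe_pow, pow_iterate, map_pow, h3]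

/-- If conjugation by `θ` raises `a ^ k` to the `q`-th power for all `k`, then `θ ^ j` conjugates
`a` to `a ^ q ^ j`. -/
theorem pow_mul_eq_pow_pow_mul {R : Type*} [Monoid R] {θ a : R} {q : ℕ}
    (h : ∀ k, θ * a ^ k = (a ^ k) ^ q * θ) (j : ℕ) : θ ^ j * a = a ^ q ^ j * θ ^ j := by
  induction j with
  | zero => simp
  | succ j ih =>
    rw [pow_succ', mul_assoc, ih, ← mul_assoc, h, ← pow_mul, ← pow_succ, mul_assoc]


/-- Let 𝒞 = S·𝒟 for some S ∈ GL_m(𝔽_q), and suppose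
Stab_l(𝒞) = Stab_l(𝒟) = 𝔽_q[A] with A having irreducible characteristic
polynomial.  Then for any Θ ∈ GL_m(𝔽_q) with Θ^m = I and Θ·B·Θ⁻¹ = B^q on
𝔽_q[A], there is j ∈ {0,…,m−1} with 𝒞 = Θ^j·𝒟. -/
theorem left_equivalent_with_field_stabilizer
    {F : Type*} [Field F] [Fintype F] {m n : ℕ}
    (C D : Submodule F (Matrix (Fin m) (Fin n) F))
    (S : Matrix (Fin m) (Fin m) F) (hS : IsUnit S)
    (hCD : (C : Set (Matrix (Fin m) (Fin n) F))
      = (fun X => S * X) '' (D : Set (Matrix (Fin m) (Fin n) F)))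
    (A : Matrix (Fin m) (Fin m) F) (hirr : Irreducible A.charpoly)
    (hstabC : {M : Matrix (Fin m) (Fin m) F | ∀ X ∈ C, M * X ∈ C}
      = {M : Matrix (Fin m) (Fin m) F | ∃ p : Polynomial F, M = Polynomial.aeval A p})
    (hstabD : {M : Matrix (Fin m) (Fin m) F | ∀ X ∈ D, M * X ∈ D}
      = {M : Matrix (Fin m) (Fin m) F | ∃ p : Polynomial F, M = Polynomial.aeval A p})
    (Θ : Matrix (Fin m) (Fin m) F) (hΘu : IsUnit Θ) (hΘm : Θ ^ m = 1)
    (hΘfrob : ∀ B : Matrix (Fin m) (Fin m) F,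
      (∃ p : Polynomial F, B = Polynomial.aeval A p) →
        Θ * B * Θ⁻¹ = B ^ (Fintype.card F)) :
    ∃ j : ℕ, j < m ∧
      (C : Set (Matrix (Fin m) (Fin n) F))
        = (fun X => Θ ^ j * X) '' (D : Set (Matrix (Fin m) (Fin n) F)) := by
  have memD (M) : (∀ X ∈ D, M * X ∈ D) ↔ ∃ p : Polynomial F, M = Polynomial.aeval A p :=
    Set.ext_iff.1 hstabD M
  have memC (M) : (∀ X ∈ C, M * X ∈ C) ↔ ∃ p : Polynomial F, M = Polynomial.aeval A p :=
    Set.ext_iff.1 hstabC M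
  have hmem (Y) : Y ∈ C ↔ ∃ X ∈ D, S * X = Y := Set.ext_iff.1 hCD Y
  obtain ⟨S, rfl⟩ := hS
  obtain ⟨Θ, rfl⟩ := hΘu
  obtain ⟨p, hp⟩ := (memC (S.val * A * S⁻¹.val)).1 fun Y hY => by
    obtain ⟨X, hX, rfl⟩ := (hmem Y).1 hY
    refine (hmem _).2 ⟨A * X, (memD A).2 ⟨Polynomial.X, by simp⟩ X hX, ?_⟩
    rw [Matrix.mul_assoc _ _ (S.val * X), ← Matrix.mul_assoc _ S.val X, Units.inv_mul,
      Matrix.one_mul, Matrix.mul_assoc]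
  obtain ⟨j, hj, hpow⟩ := Matrix.exists_aeval_eq_pow_card_pow_of_charpoly_eq hirr p
    (by rw [← hp, Matrix.coe_units_inv]; exact Matrix.charpoly_units_conj S A)
  rw [Fintype.card_fin] at hj
  have hS : S.val * A = A ^ Fintype.card F ^ j * S.val := by
    rw [← hpow, ← hp, Units.inv_mul_cancel_right]
  have hΘ : (Θ ^ j).val * A = A ^ Fintype.card F ^ j * (Θ ^ j).val := by
    rw [Units.val_pow_eq_pow_val]
    refine pow_mul_eq_pow_pow_mul (fun k => ?_) j
    rw [← hΘfrob _ ⟨Polynomial.X ^ k, by simp⟩, ← Matrix.coe_units_inv,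
      Units.inv_mul_cancel_right]
  let P : (Matrix (Fin m) (Fin m) F)ˣ := (Θ ^ j)⁻¹ * S
  have hSP : S.val = Θ.val ^ j * P.val := by
    rw [← Units.val_pow_eq_pow_val, ← Units.val_mul, mul_inv_cancel_left]
  have hPA : Commute P.val A := by
    apply (Θ ^ j).isUnit.mul_left_cancel
    rw [← mul_assoc, ← mul_assoc, hΘ, mul_assoc _ _ P.val, Units.val_pow_eq_pow_val, ← hSP, hS]
  have hP := (memD _).2
    (Matrix.exists_eq_aeval_of_commute_of_irreducible_charpoly hirr hPA)
  have hPinv := (memD _).2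
    (Matrix.exists_eq_aeval_of_commute_of_irreducible_charpoly hirr hPA.units_inv_left)
  refine ⟨j, hj, Set.ext fun Y => (hmem Y).trans ⟨?_, ?_⟩⟩
  · rintro ⟨X, hX, rfl⟩
    exact ⟨P.val * X, hP X hX, by simp only [hSP, Matrix.mul_assoc]⟩
  · rintro ⟨X, hX, rfl⟩
    refine ⟨P⁻¹.val * X, hPinv X hX, ?_⟩
    rw [hSP, Matrix.mul_assoc, ← Matrix.mul_assoc P.val, Units.mul_inv, Matrix.one_mul]
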